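/- For every τ > 0, σ > 0, x, k ∈ ℝ and every jump size y ∈ ℝ, the second-order increment Δ_{yy}Bac := Bac(τ, x + y, k, σ) − Bac(τ, x, k, σ) − y·Φ(d(x, k, σ, τ)) satisfies both bounds |Δ_{yy}Bac| ≤ 2|y| and |Δ_{yy}Bac| ≤ y²/(2·√(2π)·σ·√τ). -/

import Mathlib

open MeasureTheory Filter Set

/-- Standard normal density `φ(z) = e^{-z²/2}/√(2π)`. -/
noncomputable def stdGaussPdf (z : ℝ) : ℝ := Real.exp (-(z ^ 2) / 2) / Real.sqrt (2 * Real.pi)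

/-- Standard normal cumulative distribution function `Φ(z) = ∫_{-∞}^z φ(u) du`. -/
noncomputable def stdGaussCdf (z : ℝ) : ℝ := ∫ u in Set.Iic z, stdGaussPdf u

/-- `d(x, k, σ, τ) = (x − k)/(σ√τ)`. -/
noncomputable def dBac (x k σ τ : ℝ) : ℝ := (x - k) / (σ * Real.sqrt τ)

/-- Bachelier price `Bac(τ, x, k, σ) = (x − k)·Φ(d) + φ(d)·σ·√τ`. -/
noncomputable def Bac (τ x k σ : ℝ) : ℝ :=
  (x - k) * stdGaussCdf (dBac x k σ τ) + stdGaussPdf (dBac x k σ τ) * σ * Real.sqrt τ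

lemma sgp_eq : stdGaussPdf = ProbabilityTheory.gaussianPDFReal 0 1 := by
  funext z
  simp [stdGaussPdf, ProbabilityTheory.gaussianPDFReal, div_eq_inv_mul]

lemma sgp_integrable : Integrable stdGaussPdf := by
  rw [sgp_eq]; exact ProbabilityTheory.integrable_gaussianPDFReal 0 1

lemma sgp_nonneg (z : ℝ) : 0 ≤ stdGaussPdf z := by unfold stdGaussPdf; positivity

lemma sgp_le (z : ℝ) : stdGaussPdf z ≤ 1 / Real.sqrt (2 * Real.pi) := by
  unfold stdGaussPdf
  gcongr
  rw [Real.exp_le_one_iff]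
  nlinarith [sq_nonneg z]

lemma sgp_cont : Continuous stdGaussPdf := by unfold stdGaussPdf; fun_prop

lemma sgc_nonneg (z : ℝ) : 0 ≤ stdGaussCdf z :=
  integral_nonneg fun u => sgp_nonneg u

lemma sgc_le_one (z : ℝ) : stdGaussCdf z ≤ 1 := by
  have h1 : ∫ u, stdGaussPdf u = 1 := by
    rw [sgp_eq]; exact ProbabilityTheory.integral_gaussianPDFReal_eq_one 0 one_ne_zero
  rw [← h1]
  exact setIntegral_le_integral sgp_integrable (Eventually.of_forall sgp_nonneg)

lemma sgc_deriv (z : ℝ) : HasDerivAt stdGaussCdf (stdGaussPdf z) z := by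
  have h : stdGaussCdf = fun z => stdGaussCdf 0 + ∫ u in (0:ℝ)..z, stdGaussPdf u := by
    funext z
    have := intervalIntegral.integral_Iic_sub_Iic (a := 0) (b := z)
      sgp_integrable.integrableOn sgp_integrable.integrableOn
    unfold stdGaussCdf
    linarith
  rw [h]
  exact (intervalIntegral.integral_hasDerivAt_right (sgp_cont.intervalIntegrable _ _)
    (sgp_cont.stronglyMeasurableAtFilter _ _) sgp_cont.continuousAt).const_add _

lemma sgp_deriv (z : ℝ) : HasDerivAt stdGaussPdf (-z * stdGaussPdf z) z := by
  unfold stdGaussPdf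
  have h : HasDerivAt (fun z : ℝ => -(z ^ 2) / 2) (-z) z := by
    refine (((hasDerivAt_pow 2 z).neg).div_const 2).congr_deriv ?_
    norm_num
    ring
  refine (h.exp.div_const (Real.sqrt (2 * Real.pi))).congr_deriv ?_
  ring

lemma F_deriv (z : ℝ) :
    HasDerivAt (fun z => z * stdGaussCdf z + stdGaussPdf z) (stdGaussCdf z) z := by
  refine (((hasDerivAt_id z).mul (sgc_deriv z)).add (sgp_deriv z)).congr_deriv ?_
  simp only [id]
  ring

lemma tangent_le {f f' : ℝ → ℝ} (hf : ∀ z, HasDerivAt f (f' z) z) (hm : Monotone f')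
    (a b : ℝ) : f a + f' a * (b - a) ≤ f b := by
  have hc : Continuous f := continuous_iff_continuousAt.2 fun z => (hf z).continuousAt
  rcases lt_trichotomy a b with h | h | h
  · obtain ⟨c, hc1, hc2⟩ := exists_hasDerivAt_eq_slope f f' h hc.continuousOn fun z _ => hf z
    have := hm hc1.1.le
    rw [eq_div_iff (by linarith)] at hc2
    nlinarith
  · simp [h]
  · obtain ⟨c, hc1, hc2⟩ := exists_hasDerivAt_eq_slope f f' h hc.continuousOn fun z _ => hf z
    have := hm hc1.2.le
    rw [eq_div_iff (by linarith)] at hc2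
    nlinarith

lemma sgc_mono : Monotone stdGaussCdf :=
  monotone_of_hasDerivAt_nonneg sgc_deriv fun z => sgp_nonneg z

lemma lin_sub_mono : Monotone (fun z => 1 / Real.sqrt (2 * Real.pi) * z - stdGaussCdf z) := by
  refine monotone_of_hasDerivAt_nonneg
    (f' := fun z => 1 / Real.sqrt (2 * Real.pi) * 1 - stdGaussPdf z)
    (fun z => ((hasDerivAt_id z).const_mul _).sub (sgc_deriv z)) fun z => ?_
  have := sgp_le z
  simp only [Pi.zero_apply]
  linarith

/-- For every τ > 0, σ > 0, x, k ∈ ℝ and jump size y, the second-order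
increment `Δ_{yy}Bac = Bac(τ, x+y, k, σ) − Bac(τ, x, k, σ) − y·Φ(d)` satisfies
both `|Δ_{yy}Bac| ≤ 2|y|` and `|Δ_{yy}Bac| ≤ y²/(2√(2π)σ√τ)`. -/
theorem bachelier_second_order_increment_bounds (τ σ x k : ℝ) (hτ : 0 < τ) (hσ : 0 < σ) :
    ∀ y : ℝ,
      |Bac τ (x + y) k σ - Bac τ x k σ - y * stdGaussCdf (dBac x k σ τ)| ≤ 2 * |y| ∧
      |Bac τ (x + y) k σ - Bac τ x k σ - y * stdGaussCdf (dBac x k σ τ)|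
        ≤ y ^ 2 / (2 * Real.sqrt (2 * Real.pi) * σ * Real.sqrt τ) := by
  intro y
  have hs : 0 < σ * Real.sqrt τ := mul_pos hσ (Real.sqrt_pos.2 hτ)
  set s := σ * Real.sqrt τ with hsd
  have hq : 0 < Real.sqrt (2 * Real.pi) := Real.sqrt_pos.2 (by positivity)
  set q := Real.sqrt (2 * Real.pi) with hqd
  set a := dBac x k σ τ with ha
  set b := dBac (x + y) k σ τ with hb
  have hxa : x - k = s * a := by rw [ha, dBac, ← hsd]; field_simp
  have hxb : x + y - k = s * b := by rw [hb, dBac, ← hsd]; field_simp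
  have hy : y = s * (b - a) := by linarith
  have h1 := tangent_le F_deriv sgc_mono a b
  have h2 := tangent_le F_deriv sgc_mono b a
  have h3 := tangent_le (f := fun z => 1 / q * (z ^ 2 / 2) - (z * stdGaussCdf z + stdGaussPdf z))
    (f' := fun z => 1 / q * z - stdGaussCdf z)
    (fun z => by
      refine HasDerivAt.sub (HasDerivAt.const_mul _ ?_) (F_deriv z)
      refine ((hasDerivAt_pow 2 z).div_const 2).congr_deriv ?_
      norm_num) lin_sub_mono a b
  beta_reduce at h1 h2 h3
  have hD : Bac τ (x + y) k σ - Bac τ x k σ - y * stdGaussCdf a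
      = s * ((b * stdGaussCdf b + stdGaussPdf b) - (a * stdGaussCdf a + stdGaussPdf a)
        - (b - a) * stdGaussCdf a) := by
    unfold Bac
    rw [← ha, ← hb, hxa, hxb, hy, hsd]; ring
  rw [hD, abs_mul, abs_of_pos hs, abs_of_nonneg (by linarith)]
  constructor
  · rw [hy, abs_mul, abs_of_pos hs]
    have h4 : (b - a) * (stdGaussCdf b - stdGaussCdf a) ≤ |b - a| * 1 := by
      refine (le_abs_self _).trans ?_
      rw [abs_mul]
      gcongr
      rw [abs_le]
      constructor <;> linarith [sgc_nonneg a, sgc_nonneg b, sgc_le_one a, sgc_le_one b]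
    have h5 := abs_nonneg (b - a)
    rw [mul_left_comm]
    gcongr
    linarith
  · have h6 : y ^ 2 / (2 * q * σ * Real.sqrt τ) = s * (1 / q * ((b - a) ^ 2 / 2)) := by
      rw [mul_assoc (2 * q), ← hsd, hy]; field_simp
    rw [h6]
    gcongr
    linarith
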